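/- Under Assumption 1, the operator AV is idempotent: for every finite set X, AV(AV(X)) = AV(X). -/

import Mathlib

variable {α : Type*} [DecidableEq α]

/-- `x` is a benign element of `X`: adding it to any subset of `X` does not
change the test value. -/
def Benign (Test : Finset α → ℝ) (x : α) (X : Finset α) : Prop :=
  ∀ Y ⊆ X, Test Y = Test (Y ∪ {x})

open Classical in
/-- The set of all variable (non-benign) elements of `X`. -/
noncomputable def AV (Test : Finset α → ℝ) (X : Finset α) : Finset α :=
  X.filter (fun x => ¬ Benign Test x X)


/-- Adding benign elements of `X` to a subset of `X` does not change the test value. -/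
theorem test_union_eq_of_benign {Test : Finset α → ℝ} {X Y B : Finset α} (hY : Y ⊆ X)
    (hB : B ⊆ X) (hben : ∀ x ∈ B, Benign Test x X) : Test (Y ∪ B) = Test Y := by
  induction B using Finset.induction_on with
  | empty => simp
  | insert b B _ ih =>
    rw [Finset.insert_subset_iff] at hB
    rw [Finset.forall_mem_insert] at hben
    have hunion : Y ∪ insert b B = (Y ∪ B) ∪ {b} := by
      rw [Finset.union_insert, Finset.union_singleton]
    rw [hunion, ← hben.1 _ (Finset.union_subset hY hB.2), ih hB.2 hben.2]

open Classical in
theorem AV_subset (Test : Finset α → ℝ) (X : Finset α) : AV Test X ⊆ X :=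
  Finset.filter_subset _ _

theorem test_AV (Test : Finset α → ℝ) (X : Finset α) : Test (AV Test X) = Test X := by
  have hben : ∀ x ∈ X \ AV Test X, Benign Test x X := by
    intro x hx
    by_contra h
    simp_all [AV]
  rw [← test_union_eq_of_benign (AV_subset Test X) Finset.sdiff_subset hben,
    Finset.union_sdiff_of_subset (AV_subset Test X)]

/-- Under Assumption 1 (distinct error magnitudes), `AV` is idempotent. -/
theorem AV_idempotent (Test : Finset α → ℝ)
    (h1 : ∀ X Y : Finset α, Test X = Test Y ↔ AV Test X = AV Test Y)
    (X : Finset α) :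
    AV Test (AV Test X) = AV Test X :=
  (h1 _ _).1 (test_AV Test X)
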